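/- (Lemma: Hessian-type matrix concentration) Fix x^♮ ∈ ℝ^n and suppose a_i ~ N(0, I_n) i.i.d. for 1 ≤ i ≤ m. There are universal constants c₀, c₁ > 0 such that: (1) with probability at least 1 − O(m^{−10}), ‖(1/m) Σ_{i=1}^m (a_i^⊤ x^♮)² a_i a_i^⊤ − ‖x^♮‖₂² I_n − 2 x^♮ x^♮⊤‖ ≤ c₀ √(n log³ m / m) ‖x^♮‖₂² (operator norm), provided m > c₁ n log³ m. (2) For any fixed c₂ > 1, if m > c₁ n log³ m with c₁ sufficiently large, then with probability exceeding 1 − O(m^{−10}), the bound ‖(1/m) Σ_{i=1}^m (a_i^⊤ z)² a_i a_i^⊤ − ‖z‖₂² I_n − 2 z z^⊤‖ ≤ c₀ √(n log³ m / m) ‖z‖₂² holds simultaneously for all z ∈ ℝ^n obeying max_{1≤i≤m} |a_i^⊤ z| ≤ c₂ √(log m) ‖z‖₂. (3) On this event, ‖(1/m) Σ_{i=1}^m |a_{i,1}|² a_{i,⊥} a_{i,⊥}^⊤‖ ≤ ‖(1/m) Σ_{i=1}^m |a_{i,1}|² a_i a_i^⊤‖ ≤ 4, where a_{i,1} is the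 first entry of a_i and a_{i,⊥} the vector of its remaining entries. -/

import Mathlib

open MeasureTheory ProbabilityTheory Finset

noncomputable section

namespace PR

/-- Euclidean (ℓ²) norm on `Fin N → ℝ`. -/
def nrm {N : ℕ} (x : Fin N → ℝ) : ℝ := Real.sqrt (∑ j, x j ^ 2)

/-- Euclidean inner product on `Fin N → ℝ`. -/
def dotp {N : ℕ} (x y : Fin N → ℝ) : ℝ := ∑ j, x j * y j

/-- Standard Gaussian `N(0, I_N)` on `ℝ^N`, realized as i.i.d. standard normal coordinates. -/
def stdGaussian (N : ℕ) : Measure (Fin N → ℝ) := Measure.pi fun _ => gaussianReal 0 1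

/-- Law of `m` i.i.d. `N(0, I_N)` design vectors. -/
def design (m N : ℕ) : Measure (Fin m → Fin N → ℝ) := Measure.pi fun _ => stdGaussian N

/-- Gradient of the empirical loss `f_S(x) = (1/(4m)) ∑_{i ∈ S} [(aᵢᵀx)² − (aᵢᵀx♮)²]²`,
restricted to the samples in `S`. -/
def grad {m N : ℕ} (S : Finset (Fin m)) (a : Fin m → Fin N → ℝ) (xs x : Fin N → ℝ) :
    Fin N → ℝ :=
  (m : ℝ)⁻¹ • ∑ i ∈ S, ((dotp (a i) x ^ 2 - dotp (a i) xs ^ 2) * dotp (a i) x) • a i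

/-- Gradient descent iterates with constant stepsize `η`, started at `x0`, using samples in `S`. -/
def iter {m N : ℕ} (S : Finset (Fin m)) (a : Fin m → Fin N → ℝ) (xs : Fin N → ℝ) (η : ℝ)
    (x0 : Fin N → ℝ) : ℕ → Fin N → ℝ
  | 0 => x0
  | t + 1 => iter S a xs η x0 t - η • grad S a xs (iter S a xs η x0 t)

/-- Distance modulo the global sign ambiguity. -/
def pdist {N : ℕ} (x z : Fin N → ℝ) : ℝ := min (nrm (x - z)) (nrm (x + z))

end PR

namespace PR

/-- The last `k` coordinates `a_⊥` of a vector `a ∈ ℝ^{k+1}`. -/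
def tl {k : ℕ} (x : Fin (k + 1) → ℝ) : Fin k → ℝ := fun j => x j.succ

/-- The spectral (ℓ² operator) norm of a square matrix. -/
def opN {N : ℕ} (M : Matrix (Fin N) (Fin N) ℝ) : ℝ :=
  ‖LinearMap.toContinuousLinearMap (Matrix.toEuclideanLin M)‖

/-- The rank-one matrix `x xᵀ`. -/
def outer {N : ℕ} (x : Fin N → ℝ) : Matrix (Fin N) (Fin N) ℝ :=
  Matrix.of fun p q => x p * x q

/-- The weighted empirical covariance matrix `(1/m) ∑ᵢ cᵢ aᵢ aᵢᵀ`. -/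
def empCov {m N : ℕ} (a : Fin m → Fin N → ℝ) (c : Fin m → ℝ) : Matrix (Fin N) (Fin N) ℝ :=
  Matrix.of fun p q => (m : ℝ)⁻¹ * ∑ i, c i * a i p * a i q

end PR


namespace PR

instance instIsProbabilityMeasureStdGaussian (N : ℕ) : IsProbabilityMeasure (stdGaussian N) := by
  unfold stdGaussian; infer_instance

instance instIsProbabilityMeasureDesign (m N : ℕ) : IsProbabilityMeasure (design m N) := by
  unfold design; infer_instance

@[fun_prop]
lemma measurable_dotp {N : ℕ} (z : Fin N → ℝ) : Measurable fun a : Fin N → ℝ => dotp a z := by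
  unfold dotp; fun_prop

/-- A linear form of a standard Gaussian vector is a centred Gaussian variable. -/
lemma map_dotp_stdGaussian {N : ℕ} (z : Fin N → ℝ) :
    (stdGaussian N).map (fun a => dotp a z) = gaussianReal 0 (∑ j, z j ^ 2).toNNReal := by
  have := Measure.isProbabilityMeasure_map (μ := stdGaussian N) (measurable_dotp z).aemeasurable
  refine Measure.ext_of_charFun (funext fun t => ?_)
  have hs : (0 : ℝ) ≤ ∑ j, z j ^ 2 := Finset.sum_nonneg fun j _ => sq_nonneg _
  rw [charFun_gaussianReal, charFun_apply_real, integral_map (by fun_prop) (by fun_prop)]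
  have h1 : ∀ a : Fin N → ℝ, Complex.exp (t * (dotp a z : ℝ) * Complex.I) =
      ∏ j, Complex.exp ((t * z j : ℝ) * (a j : ℝ) * Complex.I) := by
    intro a
    rw [← Complex.exp_sum]
    congr 1
    simp only [dotp, Complex.ofReal_sum, Complex.ofReal_mul, Finset.mul_sum, Finset.sum_mul]
    exact Finset.sum_congr rfl fun j _ => by ring
  simp_rw [h1]
  rw [stdGaussian, integral_fintype_prod_eq_prod
    (f := fun j (x : ℝ) => Complex.exp ((t * z j : ℝ) * (x : ℝ) * Complex.I))]
  simp_rw [← charFun_apply_real, charFun_gaussianReal, ← Complex.exp_sum]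
  congr 1
  simp only [Real.coe_toNNReal _ hs]
  push_cast
  simp only [Finset.sum_mul, Finset.sum_div]
  simp only [mul_zero, zero_mul, zero_sub, Finset.sum_neg_distrib]
  congr 1
  exact Finset.sum_congr rfl fun j _ => by simp; ring

lemma integral_pow_four_gaussianReal (v : NNReal) :
    ∫ x, x ^ 4 ∂gaussianReal 0 v = 3 * (v : ℝ) ^ 2 := by
  have h := iteratedDeriv_mgf_zero (X := id) (μ := gaussianReal 0 v) (by simp) 4
  rw [mgf_id_gaussianReal] at h
  simp only [Pi.pow_apply, id_eq] at h
  rw [← h]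
  have d1 : deriv (fun t : ℝ => Real.exp (0 * t + v * t ^ 2 / 2)) =
      fun t => (v * t) * Real.exp (0 * t + v * t ^ 2 / 2) := by
    funext t
    have : HasDerivAt (fun t : ℝ => 0 * t + v * t ^ 2 / 2) (v * t) t := by
      have := ((hasDerivAt_id t).const_mul (0 : ℝ)).fun_add
        ((((hasDerivAt_id t).fun_pow 2).const_mul (v : ℝ)).div_const 2)
      refine this.congr_deriv ?_
      simp
      ring
    rw [this.exp.deriv]; ring
  have key : ∀ (p p' : ℝ → ℝ), (∀ t, HasDerivAt p (p' t) t) →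
      deriv (fun t : ℝ => p t * Real.exp (0 * t + v * t ^ 2 / 2)) =
      fun t => (p' t + p t * (v * t)) * Real.exp (0 * t + v * t ^ 2 / 2) := by
    intro p p' hp
    funext t
    have he : HasDerivAt (fun t : ℝ => Real.exp (0 * t + v * t ^ 2 / 2))
        ((v * t) * Real.exp (0 * t + v * t ^ 2 / 2)) t := by
      rw [← congrFun d1 t]
      exact DifferentiableAt.hasDerivAt (by fun_prop)
    rw [((hp t).fun_mul he).deriv]; ring
  have q1 : ∀ t : ℝ, HasDerivAt (fun t : ℝ => v * t) (v : ℝ) t := fun t => by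
    simpa using (hasDerivAt_id t).const_mul (v : ℝ)
  have q2 : ∀ t : ℝ, HasDerivAt (fun t : ℝ => (v : ℝ) + v * t * (v * t)) (2 * v * v * t) t := by
    intro t
    exact (((q1 t).fun_mul (q1 t)).const_add (v : ℝ)).congr_deriv (by ring)
  have q3 : ∀ t : ℝ, HasDerivAt (fun t : ℝ => 2 * v * v * t + ((v : ℝ) + v * t * (v * t)) * (v * t))
      (2 * v * v + (2 * v * v * t * (v * t) + (v + v * t * (v * t)) * v)) t := by
    intro t
    have := ((hasDerivAt_id t).const_mul (2 * v * v : ℝ)).fun_add ((q2 t).fun_mul (q1 t))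
    simpa using this
  rw [iteratedDeriv_succ, iteratedDeriv_succ, iteratedDeriv_succ, iteratedDeriv_one, d1,
    key _ _ q1, key _ _ q2, key _ _ q3]
  simp; ring

lemma integrable_dotp_pow_four {N : ℕ} (z : Fin N → ℝ) :
    Integrable (fun a => dotp a z ^ 4) (stdGaussian N) := by
  have h : Integrable (fun x : ℝ => x ^ 4) ((stdGaussian N).map (fun a => dotp a z)) := by
    rw [map_dotp_stdGaussian]
    have := (memLp_id_gaussianReal (μ := 0) (v := (∑ j, z j ^ 2).toNNReal) 4).integrable_norm_pow
      (by norm_num)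
    simpa [Even.pow_abs (show Even 4 by decide)] using this
  exact h.comp_measurable (measurable_dotp z)

lemma integral_dotp_pow_four {N : ℕ} (z : Fin N → ℝ) :
    ∫ a, dotp a z ^ 4 ∂stdGaussian N = 3 * (∑ j, z j ^ 2) ^ 2 := by
  have hs : (0 : ℝ) ≤ ∑ j, z j ^ 2 := Finset.sum_nonneg fun j _ => sq_nonneg _
  have h := integral_pow_four_gaussianReal (∑ j, z j ^ 2).toNNReal
  rw [← map_dotp_stdGaussian, integral_map (by fun_prop) (by fun_prop),
    Real.coe_toNNReal _ hs] at h
  exact h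

lemma dotp_add {N : ℕ} (a z u : Fin N → ℝ) : dotp a (z + u) = dotp a z + dotp a u := by
  simp [dotp, mul_add, Finset.sum_add_distrib]

lemma dotp_sub {N : ℕ} (a z u : Fin N → ℝ) : dotp a (z - u) = dotp a z - dotp a u := by
  simp [dotp, mul_sub, Finset.sum_sub_distrib]

lemma dotp_smul {N : ℕ} (c : ℝ) (a z : Fin N → ℝ) : dotp a (c • z) = c * dotp a z := by
  simp only [dotp, Finset.mul_sum, Pi.smul_apply, smul_eq_mul]
  exact Finset.sum_congr rfl fun j _ => by ring

lemma sq_mul_sq_eq_polarization (s w : ℝ) : s ^ 2 * w ^ 2 =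
    12⁻¹ * ((s + w) ^ 4 + (s - w) ^ 4 - 2 * s ^ 4 - 2 * w ^ 4) := by ring

lemma integrable_dotp_sq_mul_sq {N : ℕ} (z u : Fin N → ℝ) :
    Integrable (fun a => dotp a z ^ 2 * dotp a u ^ 2) (stdGaussian N) := by
  simp_rw [sq_mul_sq_eq_polarization, ← dotp_add, ← dotp_sub]
  exact ((((integrable_dotp_pow_four _).add (integrable_dotp_pow_four _)).sub
    ((integrable_dotp_pow_four _).const_mul _)).sub
    ((integrable_dotp_pow_four _).const_mul _)).const_mul _

/-- The mixed fourth moment of two linear forms of a standard Gaussian vector. -/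
lemma integral_dotp_sq_mul_sq {N : ℕ} (z u : Fin N → ℝ) :
    ∫ a, dotp a z ^ 2 * dotp a u ^ 2 ∂stdGaussian N =
      (∑ j, z j ^ 2) * (∑ j, u j ^ 2) + 2 * dotp z u ^ 2 := by
  simp_rw [sq_mul_sq_eq_polarization (dotp _ _), ← dotp_add, ← dotp_sub]
  have i := @integrable_dotp_pow_four N
  have i1 : Integrable (fun a => dotp a (z + u) ^ 4 + dotp a (z - u) ^ 4) (stdGaussian N) :=
    (i _).add (i _)
  have i2 : Integrable (fun a => dotp a (z + u) ^ 4 + dotp a (z - u) ^ 4 - 2 * dotp a z ^ 4)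
    (stdGaussian N) := i1.sub ((i _).const_mul _)
  rw [integral_const_mul, integral_sub i2 ((i _).const_mul _),
    integral_sub i1 ((i _).const_mul _), integral_add (i _) (i _), integral_const_mul,
    integral_const_mul]
  simp_rw [integral_dotp_pow_four]
  have e1 : ∑ j, (z + u) j ^ 2 = ∑ j, z j ^ 2 + ∑ j, u j ^ 2 + 2 * dotp z u := by
    simp only [dotp, Finset.mul_sum, ← Finset.sum_add_distrib, Pi.add_apply]
    exact Finset.sum_congr rfl fun j _ => by ring
  have e2 : ∑ j, (z - u) j ^ 2 = ∑ j, z j ^ 2 + ∑ j, u j ^ 2 - 2 * dotp z u := by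
    simp only [dotp, Finset.mul_sum, ← Finset.sum_add_distrib, ← Finset.sum_sub_distrib,
      Pi.sub_apply]
    exact Finset.sum_congr rfl fun j _ => by ring
  rw [e1, e2]
  ring

lemma integrable_exp_sq_gaussianReal :
    Integrable (fun x : ℝ => Real.exp (x ^ 2 / 4)) (gaussianReal 0 1) ∧
      ∫ x, Real.exp (x ^ 2 / 4) ∂gaussianReal 0 1 ≤ 2 := by
  have hpdf : ∀ x : ℝ, gaussianPDFReal 0 1 x * Real.exp (x ^ 2 / 4) =
      (√(2 * Real.pi))⁻¹ * Real.exp (-(1 / 4) * x ^ 2) := by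
    intro x
    simp only [gaussianPDFReal, NNReal.coe_one, mul_one, sub_zero]
    rw [mul_assoc, ← Real.exp_add]
    congr 2; ring
  constructor
  · rw [gaussianReal_of_var_ne_zero _ one_ne_zero,
      integrable_withDensity_iff_integrable_smul' (by fun_prop) (by simp [gaussianPDF_lt_top])]
    simp only [toReal_gaussianPDF, smul_eq_mul, hpdf]
    exact (integrable_exp_neg_mul_sq (by norm_num)).const_mul _
  · rw [integral_gaussianReal_eq_integral_smul one_ne_zero]
    simp only [smul_eq_mul, hpdf]
    rw [integral_const_mul, integral_gaussian, ← Real.sqrt_inv, ← Real.sqrt_mul (by positivity)]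
    refine Real.sqrt_le_iff.mpr ⟨by norm_num, ?_⟩
    have := Real.pi_pos
    field_simp
    norm_num

lemma integrable_exp_dotp_sq {N : ℕ} (z : Fin N → ℝ) (hz : ∑ j, z j ^ 2 ≤ 1) :
    Integrable (fun a => Real.exp (dotp a z ^ 2 / 4)) (stdGaussian N) ∧
      ∫ a, Real.exp (dotp a z ^ 2 / 4) ∂stdGaussian N ≤ 2 := by
  have hs : (0 : ℝ) ≤ ∑ j, z j ^ 2 := Finset.sum_nonneg fun j _ => sq_nonneg _
  set v := ∑ j, z j ^ 2
  have hmap : (stdGaussian N).map (fun a => dotp a z) =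
      (gaussianReal 0 1).map (fun x => √v * x) := by
    rw [map_dotp_stdGaussian, gaussianReal_map_const_mul]
    congr 1
    · simp
    · ext; simp [Real.sq_sqrt hs, v, Real.coe_toNNReal _ hs]
  have hle : ∀ x : ℝ, Real.exp ((√v * x) ^ 2 / 4) ≤ Real.exp (x ^ 2 / 4) := by
    intro x
    rw [mul_pow, Real.sq_sqrt hs]
    gcongr
    nlinarith [sq_nonneg x]
  obtain ⟨hi, hb⟩ := integrable_exp_sq_gaussianReal
  have hi2 : Integrable (fun x : ℝ => Real.exp ((√v * x) ^ 2 / 4)) (gaussianReal 0 1) :=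
    hi.mono' (by fun_prop) (.of_forall fun x => by simpa [abs_of_nonneg] using hle x)
  constructor
  · have : Integrable (fun x : ℝ => Real.exp (x ^ 2 / 4))
        ((stdGaussian N).map (fun a => dotp a z)) := by
      rw [hmap, integrable_map_measure (by fun_prop) (by fun_prop)]
      exact hi2
    exact this.comp_measurable (measurable_dotp z)
  · have : ∫ x, Real.exp (x ^ 2 / 4) ∂(stdGaussian N).map (fun a => dotp a z) ≤ 2 := by
      rw [hmap, integral_map (by fun_prop) (by fun_prop)]
      exact (integral_mono hi2 hi hle).trans hb
    rwa [integral_map (by fun_prop) (by fun_prop)] at this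

end PR


namespace PR

lemma exp_le_one_add_add_sq_mul_exp_abs (x : ℝ) :
    Real.exp x ≤ 1 + x + x ^ 2 * Real.exp |x| := by
  have h := Complex.norm_exp_sub_sum_le_norm_mul_exp (x : ℂ) 2
  rw [Finset.sum_range_succ, Finset.sum_range_one, Complex.norm_real, Real.norm_eq_abs] at h
  have h2 : Complex.exp x - ((x : ℂ) ^ 0 / (Nat.factorial 0 : ℂ) +
      (x : ℂ) ^ 1 / (Nat.factorial 1 : ℂ)) = ((Real.exp x - (1 + x) : ℝ) : ℂ) := by
    push_cast; simp
  rw [h2, Complex.norm_real, Real.norm_eq_abs, sq_abs] at h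
  linarith [le_abs_self (Real.exp x - (1 + x))]

lemma sq_le_mul_exp_sq (y : ℝ) : y ^ 2 ≤ 16 * Real.exp (y ^ 2 / 16) := by
  linarith [Real.add_one_le_exp (y ^ 2 / 16)]

lemma pow_four_le_mul_exp_sq (y : ℝ) : y ^ 4 ≤ 512 * Real.exp (y ^ 2 / 16) := by
  have := Real.quadratic_le_exp_of_nonneg (x := y ^ 2 / 16) (by positivity)
  nlinarith [sq_nonneg y]

lemma exp_sq_div_four (y : ℝ) : Real.exp (y ^ 2 / 4) = Real.exp (y ^ 2 / 16) ^ 4 := by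
  rw [← Real.exp_nat_mul]; congr 1; push_cast; ring

lemma sq_mul_sq_le_add_pow_four (p q : ℝ) : p ^ 2 * q ^ 2 ≤ (p ^ 4 + q ^ 4) / 2 := by
  nlinarith [sq_nonneg (p ^ 2 - q ^ 2)]

lemma sub_min_mul_le {s w t L : ℝ} (hL : 0 ≤ L) (hexp : Real.exp (-(L / 16)) ≤ t) :
    (s ^ 2 - min (s ^ 2) L) * w ^ 2 ≤
      t * (128 * (Real.exp (s ^ 2 / 4) + Real.exp (w ^ 2 / 4))) := by
  have hdiff : s ^ 2 - min (s ^ 2) L ≤ s ^ 2 * Real.exp (s ^ 2 / 16) * t := by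
    have h1 : s ^ 2 - min (s ^ 2) L ≤ s ^ 2 * Real.exp ((s ^ 2 - L) / 16) := by
      rcases le_total (s ^ 2) L with h | h
      · rw [min_eq_left h, sub_self]; positivity
      · rw [min_eq_right h]
        have h1 : 1 ≤ Real.exp ((s ^ 2 - L) / 16) := Real.one_le_exp (by linarith)
        linarith [mul_le_mul_of_nonneg_left h1 (sq_nonneg s)]
    refine h1.trans ?_
    rw [mul_assoc]
    gcongr
    rw [show (s ^ 2 - L) / 16 = s ^ 2 / 16 + -(L / 16) by ring, Real.exp_add]
    gcongr
  have ht : 0 ≤ t := (Real.exp_pos _).le.trans hexp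
  have s1 := sq_le_mul_exp_sq s
  have w1 := sq_le_mul_exp_sq w
  rw [exp_sq_div_four, exp_sq_div_four]
  set p := Real.exp (s ^ 2 / 16)
  set q := Real.exp (w ^ 2 / 16)
  have hp0 : 0 ≤ p := (Real.exp_pos _).le
  have hq1 : 1 ≤ q := Real.one_le_exp (by positivity)
  have hppq : p ^ 2 * q ≤ p ^ 2 * q ^ 2 := by
    have : q ≤ q ^ 2 := by nlinarith
    gcongr
  calc (s ^ 2 - min (s ^ 2) L) * w ^ 2 ≤ (s ^ 2 * p * t) * w ^ 2 := by gcongr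
    _ ≤ (16 * p * p * t) * (16 * q) := by gcongr
    _ = t * (256 * (p ^ 2 * q)) := by ring
    _ ≤ t * (128 * (p ^ 4 + q ^ 4)) := by
        gcongr t * ?_
        linarith [sq_mul_sq_le_add_pow_four p q]

lemma sq_mul_exp_abs_truncated_le {s w μ θ t L : ℝ} (hθ : |θ| = t) (hL : 1 ≤ L)
    (htL : t * L ≤ 1 / 16) (hμ0 : 0 ≤ μ) (hμ : μ ≤ 3) :
    (θ * (min (s ^ 2) L * w ^ 2 - μ)) ^ 2 * Real.exp |θ * (min (s ^ 2) L * w ^ 2 - μ)| ≤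
      t ^ 2 * (399000 * (Real.exp (s ^ 2 / 4) + Real.exp (w ^ 2 / 4))) := by
  have ht0 : 0 ≤ t := hθ ▸ abs_nonneg θ
  have ht : t ≤ 1 / 16 := le_trans (le_mul_of_one_le_right ht0 hL) htL
  have hX0 : 0 ≤ min (s ^ 2) L := le_min (sq_nonneg s) (by linarith)
  have hX1 : min (s ^ 2) L ≤ s ^ 2 := min_le_left _ _
  have hX2 : min (s ^ 2) L ≤ L := min_le_right _ _
  have s2 := pow_four_le_mul_exp_sq s
  have w2 := pow_four_le_mul_exp_sq w
  set Y := min (s ^ 2) L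
  have hYw : 0 ≤ Y * w ^ 2 := by positivity
  have h1 : |θ * (Y * w ^ 2 - μ)| ≤ 1 + w ^ 2 / 16 := by
    rw [abs_mul, hθ]
    have h2 : |Y * w ^ 2 - μ| ≤ L * w ^ 2 + 3 := by
      have : Y * w ^ 2 ≤ L * w ^ 2 := by gcongr
      rw [abs_le]; constructor <;> linarith
    have h3 := mul_le_mul_of_nonneg_left h2 ht0
    have h4 := mul_le_mul_of_nonneg_right htL (sq_nonneg w)
    linarith
  have h3 : (Y * w ^ 2 - μ) ^ 2 ≤ s ^ 4 * w ^ 4 + 9 := by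
    have a1 : (Y * w ^ 2) ^ 2 ≤ (s ^ 2 * w ^ 2) ^ 2 := by gcongr
    have a2 : (s ^ 2 * w ^ 2) ^ 2 = s ^ 4 * w ^ 4 := by ring
    have a3 : μ ^ 2 ≤ 3 ^ 2 := by gcongr
    have a4 := mul_nonneg hYw hμ0
    linarith [sub_sq (Y * w ^ 2) μ]
  have hθ2 : θ ^ 2 = t ^ 2 := by rw [← hθ, sq_abs]
  rw [exp_sq_div_four, exp_sq_div_four, mul_pow, hθ2]
  have h2 : Real.exp |θ * (Y * w ^ 2 - μ)| ≤ 3 * Real.exp (w ^ 2 / 16) := by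
    refine (Real.exp_le_exp.mpr h1).trans ?_
    rw [Real.exp_add]
    gcongr
    linarith [Real.exp_one_lt_d9]
  set p := Real.exp (s ^ 2 / 16)
  set q := Real.exp (w ^ 2 / 16)
  have hp1 : 1 ≤ p := Real.one_le_exp (by positivity)
  have hq1 : 1 ≤ q := Real.one_le_exp (by positivity)
  have h4 : s ^ 4 * w ^ 4 ≤ (512 * p) * (512 * q) := by gcongr
  have hpqq : p * q ^ 2 ≤ p ^ 2 * q ^ 2 := by
    have : p ≤ p ^ 2 := le_self_pow₀ hp1 (by norm_num)
    gcongr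
  have hq4 : q ≤ q ^ 4 := le_self_pow₀ hq1 (by norm_num)
  have hp4 : 0 ≤ p ^ 4 := by positivity
  calc t ^ 2 * (Y * w ^ 2 - μ) ^ 2 * Real.exp |θ * (Y * w ^ 2 - μ)|
      ≤ t ^ 2 * ((512 * p) * (512 * q) + 9) * (3 * q) := by
        gcongr
        exact h3.trans (by linarith)
    _ = t ^ 2 * (786432 * (p * q ^ 2) + 27 * q) := by ring
    _ ≤ t ^ 2 * (399000 * (p ^ 4 + q ^ 4)) := by
        gcongr t ^ 2 * ?_
        linarith [sq_mul_sq_le_add_pow_four p q]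

/-- Pointwise quadratic bound for the exponential of a centred truncated product, with an
envelope of finite Gaussian mean. -/
lemma exp_mul_truncated_le {s w μ θ t L : ℝ} (hθ : |θ| = t) (hL : 1 ≤ L) (htL : t * L ≤ 1 / 16)
    (hμ0 : 0 ≤ μ) (hμ : μ ≤ 3) (hexp : Real.exp (-(L / 16)) ≤ t) :
    Real.exp (θ * (min (s ^ 2) L * w ^ 2 - μ)) ≤
      1 + θ * (s ^ 2 * w ^ 2 - μ) +
        400000 * t ^ 2 * (Real.exp (s ^ 2 / 4) + Real.exp (w ^ 2 / 4)) := by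
  have ht0 : 0 ≤ t := hθ ▸ abs_nonneg θ
  have hfin := exp_le_one_add_add_sq_mul_exp_abs (θ * (min (s ^ 2) L * w ^ 2 - μ))
  have hquad := sq_mul_exp_abs_truncated_le (s := s) (w := w) hθ hL htL hμ0 hμ
  have hlin := mul_le_mul_of_nonneg_left (sub_min_mul_le (s := s) (w := w) (by linarith) hexp) ht0
  have h0 : 0 ≤ (s ^ 2 - min (s ^ 2) L) * w ^ 2 :=
    mul_nonneg (sub_nonneg.mpr (min_le_left _ _)) (sq_nonneg w)
  have h1 : (-θ) * ((s ^ 2 - min (s ^ 2) L) * w ^ 2) ≤ t * ((s ^ 2 - min (s ^ 2) L) * w ^ 2) :=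
    mul_le_mul_of_nonneg_right (hθ ▸ neg_le_abs θ) h0
  have : 0 ≤ t ^ 2 * (Real.exp (s ^ 2 / 4) + Real.exp (w ^ 2 / 4)) := by positivity
  linarith

/-- The truncated summand `min((aᵀz)², L) (aᵀu)²`. -/
def truncProd {N : ℕ} (L : ℝ) (z u a : Fin N → ℝ) : ℝ := min (dotp a z ^ 2) L * dotp a u ^ 2

/-- The population value `‖z‖²‖u‖² + 2 (zᵀu)²` of `(aᵀz)² (aᵀu)²`. -/
def popMean {N : ℕ} (z u : Fin N → ℝ) : ℝ :=
  (∑ j, z j ^ 2) * (∑ j, u j ^ 2) + 2 * dotp z u ^ 2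

lemma dotp_sq_le {N : ℕ} (z u : Fin N → ℝ) :
    dotp z u ^ 2 ≤ (∑ j, z j ^ 2) * ∑ j, u j ^ 2 :=
  Finset.sum_mul_sq_le_sq_mul_sq _ _ _

lemma popMean_nonneg {N : ℕ} (z u : Fin N → ℝ) : 0 ≤ popMean z u := by
  unfold popMean; positivity

lemma popMean_le_three {N : ℕ} {z u : Fin N → ℝ} (hz : ∑ j, z j ^ 2 ≤ 1) (hu : ∑ j, u j ^ 2 ≤ 1) :
    popMean z u ≤ 3 := by
  have h := dotp_sq_le z u
  have : (∑ j, z j ^ 2) * ∑ j, u j ^ 2 ≤ 1 := mul_le_one₀ hz (by positivity) hu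
  unfold popMean; linarith

lemma integral_exp_truncProd_le {N : ℕ} {z u : Fin N → ℝ} {θ t L : ℝ} (hz : ∑ j, z j ^ 2 ≤ 1)
    (hu : ∑ j, u j ^ 2 ≤ 1) (hθ : |θ| = t) (hL : 1 ≤ L) (htL : t * L ≤ 1 / 16)
    (hexp : Real.exp (-(L / 16)) ≤ t) :
    Integrable (fun a => Real.exp (θ * (truncProd L z u a - popMean z u))) (stdGaussian N) ∧
      ∫ a, Real.exp (θ * (truncProd L z u a - popMean z u)) ∂stdGaussian N ≤
        Real.exp (1600000 * t ^ 2) := by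
  obtain ⟨iz, bz⟩ := integrable_exp_dotp_sq z hz
  obtain ⟨iu, bu⟩ := integrable_exp_dotp_sq u hu
  have hle : ∀ a : Fin N → ℝ, Real.exp (θ * (truncProd L z u a - popMean z u)) ≤
      1 + θ * (dotp a z ^ 2 * dotp a u ^ 2 - popMean z u) + 400000 * t ^ 2 *
        (Real.exp (dotp a z ^ 2 / 4) + Real.exp (dotp a u ^ 2 / 4)) := fun a =>
    exp_mul_truncated_le hθ hL htL (popMean_nonneg z u) (popMean_le_three hz hu) hexp
  have i1 : Integrable (fun a => dotp a z ^ 2 * dotp a u ^ 2 - popMean z u) (stdGaussian N) :=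
    (integrable_dotp_sq_mul_sq z u).sub (integrable_const _)
  have i2 : Integrable (fun a => 1 + θ * (dotp a z ^ 2 * dotp a u ^ 2 - popMean z u))
      (stdGaussian N) := (integrable_const _).add (i1.const_mul θ)
  have i3 : Integrable (fun a => Real.exp (dotp a z ^ 2 / 4) + Real.exp (dotp a u ^ 2 / 4))
      (stdGaussian N) := iz.add iu
  have i4 := i2.add (i3.const_mul (400000 * t ^ 2))
  have hint : Integrable (fun a => Real.exp (θ * (truncProd L z u a - popMean z u)))
      (stdGaussian N) := by
    refine i4.mono' ?_ (.of_forall fun a => ?_)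
    · unfold truncProd
      exact Measurable.aestronglyMeasurable (by fun_prop)
    · rw [Real.norm_eq_abs, Real.abs_exp]; exact hle a
  refine ⟨hint, (integral_mono hint i4 hle).trans ?_⟩
  change ∫ a, (1 + θ * (dotp a z ^ 2 * dotp a u ^ 2 - popMean z u) + 400000 * t ^ 2 *
        (Real.exp (dotp a z ^ 2 / 4) + Real.exp (dotp a u ^ 2 / 4))) ∂stdGaussian N ≤ _
  rw [integral_add i2 (i3.const_mul _), integral_add (integrable_const _) (i1.const_mul _),
    integral_const_mul, integral_const_mul, integral_add iz iu,
    integral_sub (integrable_dotp_sq_mul_sq z u) (integrable_const _), integral_dotp_sq_mul_sq]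
  simp only [integral_const, probReal_univ, one_smul]
  have h1 := Real.add_one_le_exp (1600000 * t ^ 2)
  have : popMean z u = (∑ j, z j ^ 2) * (∑ j, u j ^ 2) + 2 * dotp z u ^ 2 := rfl
  rw [← this, sub_self, mul_zero]
  nlinarith [sq_nonneg t]

/-- Chernoff bound for the sum of truncated products over the design. -/
lemma design_real_chernoff {m N : ℕ} {z u : Fin N → ℝ} {θ t L : ℝ} (hz : ∑ j, z j ^ 2 ≤ 1)
    (hu : ∑ j, u j ^ 2 ≤ 1) (hθ : |θ| = t) (hL : 1 ≤ L) (htL : t * L ≤ 1 / 16)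
    (hexp : Real.exp (-(L / 16)) ≤ t) (r : ℝ) :
    (design m N).real {a | r ≤ θ * ∑ i, (truncProd L z u (a i) - popMean z u)} ≤
      Real.exp (1600000 * (m * t ^ 2) - r) := by
  obtain ⟨hi, hb⟩ := integral_exp_truncProd_le hz hu hθ hL htL hexp
  set g : (Fin N → ℝ) → ℝ := fun a => Real.exp (θ * (truncProd L z u a - popMean z u))
  have hprod : ∀ a : Fin m → Fin N → ℝ,
      Real.exp (θ * ∑ i, (truncProd L z u (a i) - popMean z u)) = ∏ i, g (a i) := by
    intro a
    rw [Finset.mul_sum, Real.exp_sum]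
  have hint : Integrable (fun a : Fin m → Fin N → ℝ => ∏ i, g (a i)) (design m N) :=
    Integrable.fintype_prod (f := fun _ => g) fun _ => hi
  have hval : ∫ a : Fin m → Fin N → ℝ, ∏ i, g (a i) ∂design m N ≤
      Real.exp (1600000 * (m * t ^ 2)) := by
    rw [design, integral_fintype_prod_eq_pow]
    refine (pow_le_pow_left₀ (integral_nonneg fun a => (Real.exp_pos _).le) hb _).trans ?_
    rw [← Real.exp_nat_mul, Fintype.card_fin]
    exact Real.exp_le_exp.mpr (by linarith)
  rw [← funext hprod] at hint hval
  have hm := mul_meas_ge_le_integral_of_nonneg (μ := design m N)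
    (.of_forall fun a => (Real.exp_pos _).le) hint (Real.exp r)
  simp only [Real.exp_le_exp] at hm
  rw [Real.exp_sub, le_div_iff₀ (Real.exp_pos r), mul_comm]
  exact hm.trans hval

/-- Gaussian tail bound for a linear form of a single design vector. -/
lemma design_real_abs_dotp_ge_le {m N : ℕ} (i : Fin m) {z : Fin N → ℝ} (hz : ∑ j, z j ^ 2 ≤ 1)
    {r : ℝ} (hr : 0 ≤ r) :
    (design m N).real {a | r ≤ |dotp (a i) z|} ≤ 2 * Real.exp (-(r ^ 2 / 4)) := by
  obtain ⟨hi, hb⟩ := integrable_exp_dotp_sq z hz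
  have hp : (design m N).real {a | r ≤ |dotp (a i) z|} =
      (stdGaussian N).real {x | r ≤ |dotp x z|} := by
    have := measurePreserving_eval (fun _ : Fin m => stdGaussian N) i
    exact this.measureReal_preimage (s := {x | r ≤ |dotp x z|})
      (measurableSet_le measurable_const (by fun_prop)).nullMeasurableSet
  have hm := mul_meas_ge_le_integral_of_nonneg (μ := stdGaussian N)
    (.of_forall fun a => (Real.exp_pos _).le) hi (Real.exp (r ^ 2 / 4))
  have hset : {x : Fin N → ℝ | r ≤ |dotp x z|} =
      {x | Real.exp (r ^ 2 / 4) ≤ Real.exp (dotp x z ^ 2 / 4)} := by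
    ext x
    simp only [Set.mem_ofPred_eq, Real.exp_le_exp]
    rw [div_le_div_iff_of_pos_right (by norm_num), ← sq_abs (dotp x z),
      sq_le_sq₀ hr (abs_nonneg _)]
  rw [hp, hset, Real.exp_neg, ← div_eq_mul_inv, le_div_iff₀ (Real.exp_pos _), mul_comm]
  exact hm.trans hb

end PR


namespace PR

lemma exists_grid_point {K : ℕ} (hK : 0 < K) {x : ℝ} (hx : x ^ 2 ≤ 1) :
    ∃ k ∈ Finset.Icc (-(K : ℤ)) K, |x - k / K| ≤ 1 / K ∧ ((k : ℝ) / K) ^ 2 ≤ x ^ 2 := by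
  have hK' : (0 : ℝ) < K := by exact_mod_cast hK
  have key : ∀ y : ℝ, 0 ≤ y → y ≤ 1 →
      ∃ k : ℤ, 0 ≤ k ∧ k ≤ K ∧ 0 ≤ y - k / K ∧ y - k / K ≤ 1 / K := by
    intro y h0 h1
    have hf := Int.floor_le (y * K)
    have hf' := Int.lt_floor_add_one (y * K)
    refine ⟨⌊y * K⌋, Int.floor_nonneg.mpr (by positivity), ?_, ?_, ?_⟩
    · exact_mod_cast hf.trans (show y * K ≤ K by nlinarith)
    · rw [sub_nonneg, div_le_iff₀ hK']; exact hf
    · rw [sub_le_iff_le_add, ← add_div, le_div_iff₀ hK']; linarith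
  have habs : |x| ≤ 1 := (sq_le_one_iff_abs_le_one x).mp hx
  obtain ⟨k, hk0, hkK, hd0, hd1⟩ := key |x| (abs_nonneg x) habs
  have hk0' : (0 : ℝ) ≤ k := by exact_mod_cast hk0
  have hsq : ((k : ℝ) / K) ^ 2 ≤ x ^ 2 := by
    rw [← sq_abs x]
    exact pow_le_pow_left₀ (by positivity) (by linarith) 2
  rcases abs_cases x with ⟨hx, _⟩ | ⟨hx, _⟩
  · refine ⟨k, Finset.mem_Icc.mpr ⟨by omega, hkK⟩, ?_, hsq⟩
    rw [← hx, abs_of_nonneg hd0]; exact hd1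
  · refine ⟨-k, Finset.mem_Icc.mpr ⟨by omega, by omega⟩, ?_, ?_⟩
    · rw [abs_sub_comm]
      push_cast
      rw [show -(k : ℝ) / K - x = |x| - k / K by rw [hx]; ring, abs_of_nonneg hd0]
      exact hd1
    · push_cast
      rw [neg_div, neg_sq]; exact hsq

/-- A grid in the unit ball approximating every point of the ball coordinatewise. -/
lemma exists_net (N : ℕ) {K : ℕ} (hK : 0 < K) :
    ∃ S : Finset (Fin N → ℝ), S.card ≤ (2 * K + 1) ^ N ∧ (∀ z ∈ S, ∑ j, z j ^ 2 ≤ 1) ∧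
      ∀ z : Fin N → ℝ, ∑ j, z j ^ 2 ≤ 1 → ∃ z' ∈ S, ∀ j, |z j - z' j| ≤ 1 / K := by
  classical
  set G : Finset ℝ := (Finset.Icc (-(K : ℤ)) K).image fun k : ℤ => (k : ℝ) / K
  have hG : G.card ≤ 2 * K + 1 := by
    refine Finset.card_image_le.trans ?_
    rw [Int.card_Icc]; omega
  refine ⟨(Fintype.piFinset fun _ : Fin N => G).filter fun z => ∑ j, z j ^ 2 ≤ 1, ?_, ?_, ?_⟩
  · refine (Finset.card_filter_le _ _).trans ?_
    rw [Fintype.card_piFinset_const]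
    simpa using Nat.pow_le_pow_left hG N
  · intro z hz
    exact (Finset.mem_filter.mp hz).2
  · intro z hz
    have hj : ∀ j, z j ^ 2 ≤ 1 := fun j =>
      (Finset.single_le_sum (f := fun j => z j ^ 2) (fun _ _ => sq_nonneg _)
        (Finset.mem_univ j)).trans hz
    choose k hk hd hs using fun j => exists_grid_point hK (hj j)
    refine ⟨fun j => (k j : ℝ) / K, Finset.mem_filter.mpr ⟨?_, ?_⟩, hd⟩
    · exact Fintype.mem_piFinset.mpr fun j => Finset.mem_image.mpr ⟨k j, hk j, rfl⟩
    · exact (Finset.sum_le_sum fun j _ => hs j).trans hz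

lemma abs_dotp_le {N : ℕ} {a v : Fin N → ℝ} {A B : ℝ} (hA : 0 ≤ A) (ha : ∀ j, |a j| ≤ A)
    (hv : ∀ j, |v j| ≤ B) : |dotp a v| ≤ N * (A * B) := by
  refine (Finset.abs_sum_le_sum_abs _ _).trans ?_
  have : ∀ j ∈ Finset.univ, |a j * v j| ≤ A * B := fun j _ => by
    rw [abs_mul]
    exact mul_le_mul (ha j) (hv j) (abs_nonneg _) hA
  simpa using Finset.sum_le_card_nsmul _ _ _ this

lemma abs_le_one_of_sum_sq_le {N : ℕ} {z : Fin N → ℝ} (hz : ∑ j, z j ^ 2 ≤ 1) (j : Fin N) :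
    |z j| ≤ 1 :=
  (sq_le_one_iff_abs_le_one _).mp <| (Finset.single_le_sum (f := fun j => z j ^ 2)
    (fun _ _ => sq_nonneg _) (Finset.mem_univ j)).trans hz

lemma abs_sq_sub_sq_le {x y d B : ℝ} (hd : |x - y| ≤ d) (hx : |x| ≤ B) (hy : |y| ≤ B) :
    |x ^ 2 - y ^ 2| ≤ 2 * B * d := by
  rw [sq_sub_sq, abs_mul]
  have h1 : |x + y| ≤ 2 * B := (abs_add_le x y).trans (by linarith)
  exact mul_le_mul h1 hd (abs_nonneg _) ((abs_nonneg _).trans h1)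

lemma abs_mul_sub_mul_le {x y x' y' d e A B : ℝ} (hx : |x - x'| ≤ d) (hy : |y - y'| ≤ e)
    (hA : |y| ≤ A) (hB : |x'| ≤ B) : |x * y - x' * y'| ≤ d * A + B * e := by
  rw [show x * y - x' * y' = (x - x') * y + x' * (y - y') by ring]
  refine (abs_add_le _ _).trans ?_
  rw [abs_mul, abs_mul]
  exact add_le_add (mul_le_mul hx hA (abs_nonneg _) ((abs_nonneg _).trans hx))
    (mul_le_mul hB hy (abs_nonneg _) ((abs_nonneg _).trans hB))

lemma abs_truncProd_sub_le {N : ℕ} {a z z' u u' : Fin N → ℝ} {L δ R : ℝ} (hL : 0 ≤ L)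
    (hR : 0 ≤ R) (ha : ∀ j, |a j| ≤ R) (hz : ∑ j, z j ^ 2 ≤ 1) (hz' : ∑ j, z' j ^ 2 ≤ 1)
    (hu : ∑ j, u j ^ 2 ≤ 1) (hu' : ∑ j, u' j ^ 2 ≤ 1) (hzz : ∀ j, |z j - z' j| ≤ δ)
    (huu : ∀ j, |u j - u' j| ≤ δ) :
    |truncProd L z u a - truncProd L z' u' a| ≤ 4 * (N * R) ^ 4 * δ := by
  have hb : ∀ v : Fin N → ℝ, ∑ j, v j ^ 2 ≤ 1 → |dotp a v| ≤ N * R := fun v hv => by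
    simpa using abs_dotp_le hR ha (abs_le_one_of_sum_sq_le hv)
  have hd : ∀ v v' : Fin N → ℝ, (∀ j, |v j - v' j| ≤ δ) →
      |dotp a v - dotp a v'| ≤ N * (R * δ) := fun v v' h => by
    rw [← dotp_sub]; exact abs_dotp_le hR ha h
  have hsq : ∀ v : Fin N → ℝ, ∑ j, v j ^ 2 ≤ 1 → dotp a v ^ 2 ≤ (N * R) ^ 2 := fun v hv => by
    rw [← sq_abs]; exact pow_le_pow_left₀ (abs_nonneg _) (hb v hv) 2
  have h1 := abs_sq_sub_sq_le (hd z z' hzz) (hb z hz) (hb z' hz')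
  have h2 := abs_sq_sub_sq_le (hd u u' huu) (hb u hu) (hb u' hu')
  have h3 : |min (dotp a z ^ 2) L - min (dotp a z' ^ 2) L| ≤ 2 * (N * R) * (N * (R * δ)) := by
    refine (abs_min_sub_min_le_max _ _ _ _).trans ?_
    rw [sub_self, abs_zero, max_eq_left (abs_nonneg _)]
    exact h1
  have h4 : |min (dotp a z' ^ 2) L| ≤ (N * R) ^ 2 := by
    rw [abs_of_nonneg (le_min (sq_nonneg _) hL)]
    exact (min_le_left _ _).trans (hsq z' hz')
  have h5 : |dotp a u ^ 2| ≤ (N * R) ^ 2 := by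
    rw [abs_of_nonneg (sq_nonneg _)]; exact hsq u hu
  refine (abs_mul_sub_mul_le h3 h2 h5 h4).trans (le_of_eq ?_)
  ring

lemma abs_popMean_sub_le {N : ℕ} {z z' u u' : Fin N → ℝ} {δ : ℝ} (hz : ∑ j, z j ^ 2 ≤ 1)
    (hz' : ∑ j, z' j ^ 2 ≤ 1) (hu : ∑ j, u j ^ 2 ≤ 1) (hu' : ∑ j, u' j ^ 2 ≤ 1)
    (hzz : ∀ j, |z j - z' j| ≤ δ) (huu : ∀ j, |u j - u' j| ≤ δ) :
    |popMean z u - popMean z' u'| ≤ 12 * N * δ := by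
  have hsq : ∀ v v' : Fin N → ℝ, ∑ j, v j ^ 2 ≤ 1 → ∑ j, v' j ^ 2 ≤ 1 →
      (∀ j, |v j - v' j| ≤ δ) → |∑ j, v j ^ 2 - ∑ j, v' j ^ 2| ≤ N * (2 * δ) := by
    intro v v' hv hv' h
    have : ∑ j, v j ^ 2 - ∑ j, v' j ^ 2 = dotp (v + v') (v - v') := by
      rw [dotp, ← Finset.sum_sub_distrib]
      exact Finset.sum_congr rfl fun j _ => sq_sub_sq _ _
    rw [this]
    refine abs_dotp_le (by norm_num) (fun j => ?_) h
    refine (abs_add_le _ _).trans ?_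
    linarith [abs_le_one_of_sum_sq_le hv j, abs_le_one_of_sum_sq_le hv' j]
  have hn : ∀ v : Fin N → ℝ, ∑ j, v j ^ 2 ≤ 1 → |∑ j, v j ^ 2| ≤ 1 := fun v hv => by
    rwa [abs_of_nonneg (Finset.sum_nonneg fun j _ => sq_nonneg _)]
  have hdot : ∀ v w : Fin N → ℝ, ∑ j, v j ^ 2 ≤ 1 → ∑ j, w j ^ 2 ≤ 1 → |dotp v w| ≤ 1 := by
    intro v w hv hw
    exact (sq_le_one_iff_abs_le_one _).mp
      ((dotp_sq_le v w).trans (mul_le_one₀ hv (by positivity) hw))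
  have h1 := abs_mul_sub_mul_le (hsq z z' hz hz' hzz) (hsq u u' hu hu' huu) (hn u hu) (hn z' hz')
  have h2 : |dotp z u - dotp z' u'| ≤ N * (2 * δ) := by
    have e : dotp z u - dotp z' u' = dotp u (z - z') + dotp z' (u - u') := by
      rw [dotp_sub, dotp_sub]
      simp only [dotp, mul_comm]
      ring
    rw [e]
    have a1 : |dotp u (z - z')| ≤ N * (1 * δ) :=
      abs_dotp_le zero_le_one (abs_le_one_of_sum_sq_le hu) hzz
    have a2 : |dotp z' (u - u')| ≤ N * (1 * δ) :=
      abs_dotp_le zero_le_one (abs_le_one_of_sum_sq_le hz') huu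
    refine (abs_add_le _ _).trans ?_
    linarith
  have h3 := abs_sq_sub_sq_le h2 (hdot z u hz hu) (hdot z' u' hz' hu')
  have e : popMean z u - popMean z' u' =
      ((∑ j, z j ^ 2) * (∑ j, u j ^ 2) - (∑ j, z' j ^ 2) * (∑ j, u' j ^ 2)) +
        2 * (dotp z u ^ 2 - dotp z' u' ^ 2) := by
    unfold popMean; ring
  rw [e]
  refine (abs_add_le _ _).trans ?_
  rw [abs_mul, abs_two]
  linarith

/-- The quadratic form of a symmetric matrix controls its spectral norm. -/
lemma opN_le_of_quadratic {N : ℕ} {M : Matrix (Fin N) (Fin N) ℝ} (hM : M.IsHermitian) {ε : ℝ}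
    (hε : 0 ≤ ε) (h : ∀ u, |dotp u (M.mulVec u)| ≤ ε * ∑ j, u j ^ 2) : opN M ≤ ε := by
  unfold opN
  have hs := Matrix.isSymmetric_toEuclideanLin_iff.mpr hM
  rw [ContinuousLinearMap.norm_eq_iSup_rayleighQuotient
    (T := LinearMap.toContinuousLinearMap (Matrix.toEuclideanLin M)) hs]
  refine ciSup_le fun x => ?_
  rw [ContinuousLinearMap.rayleighQuotient, abs_div, abs_sq]
  refine div_le_of_le_mul₀ (sq_nonneg _) hε ?_
  rw [EuclideanSpace.real_norm_sq_eq]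
  refine le_trans (le_of_eq ?_) (h x.ofLp)
  congr 1

lemma opN_submatrix_succ_le {k : ℕ} (M : Matrix (Fin (k + 1)) (Fin (k + 1)) ℝ) :
    opN (M.submatrix Fin.succ Fin.succ) ≤ opN M := by
  refine ContinuousLinearMap.opNorm_le_bound _ (norm_nonneg _) fun x => ?_
  set y : EuclideanSpace ℝ (Fin (k + 1)) := WithLp.toLp 2 (Fin.cons 0 x.ofLp)
  have hy : ‖y‖ = ‖x‖ := by
    rw [EuclideanSpace.norm_eq, EuclideanSpace.norm_eq, Fin.sum_univ_succ]
    simp [y]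
  refine le_trans ?_ ((ContinuousLinearMap.le_opNorm
    (LinearMap.toContinuousLinearMap (Matrix.toEuclideanLin M)) y).trans_eq (by rw [hy]; rfl))
  have hc : ∀ i : Fin k, (Matrix.toEuclideanLin (M.submatrix Fin.succ Fin.succ) x) i =
      (Matrix.toEuclideanLin M y) i.succ := by
    intro i
    simp [Matrix.toEuclideanLin, Matrix.toLpLin_apply, Matrix.mulVec, dotProduct,
      Fin.sum_univ_succ, y]
  simp only [LinearMap.coe_toContinuousLinearMap']
  rw [EuclideanSpace.norm_eq, EuclideanSpace.norm_eq, Fin.sum_univ_succ]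
  simp only [hc]
  exact Real.sqrt_le_sqrt (le_add_of_nonneg_left (by positivity))

lemma empCov_isHermitian {m N : ℕ} (a : Fin m → Fin N → ℝ) (c : Fin m → ℝ) :
    (empCov a c).IsHermitian := by
  ext p q
  simp only [empCov, Matrix.conjTranspose_apply, Matrix.of_apply, star_trivial]
  congr 1
  exact Finset.sum_congr rfl fun i _ => by ring

lemma dotp_empCov_mulVec {m N : ℕ} (a : Fin m → Fin N → ℝ) (c : Fin m → ℝ) (u : Fin N → ℝ) :
    dotp u ((empCov a c).mulVec u) = (m : ℝ)⁻¹ * ∑ i, c i * dotp (a i) u ^ 2 := by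
  simp only [dotp, Matrix.mulVec, dotProduct, empCov, Matrix.of_apply, sq, Finset.mul_sum,
    Finset.sum_mul]
  rw [Finset.sum_comm]
  rw [Finset.sum_congr rfl fun p _ => Finset.sum_comm]
  rw [Finset.sum_comm]
  exact Finset.sum_congr rfl fun i _ => Finset.sum_congr rfl fun p _ =>
    Finset.sum_congr rfl fun q _ => by ring

lemma dotp_outer_mulVec {N : ℕ} (z u : Fin N → ℝ) :
    dotp u ((outer z).mulVec u) = dotp z u ^ 2 := by
  simp only [dotp, Matrix.mulVec, dotProduct, outer, Matrix.of_apply, sq, Finset.mul_sum,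
    Finset.sum_mul]
  exact Finset.sum_congr rfl fun p _ => Finset.sum_congr rfl fun q _ => by ring

lemma nrm_sq {N : ℕ} (z : Fin N → ℝ) : nrm z ^ 2 = ∑ j, z j ^ 2 :=
  Real.sq_sqrt (Finset.sum_nonneg fun _ _ => sq_nonneg _)

/-- A bound on the fluctuations of the empirical fourth-order form yields the spectral bound. -/
lemma opN_empCov_sub_le {m N : ℕ} {a : Fin m → Fin N → ℝ} {z : Fin N → ℝ} {ε : ℝ} (hε : 0 ≤ ε)
    (h : ∀ u, |(m : ℝ)⁻¹ * ∑ i, dotp (a i) z ^ 2 * dotp (a i) u ^ 2 - popMean z u| ≤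
      ε * ((∑ j, z j ^ 2) * ∑ j, u j ^ 2)) :
    opN (empCov a (fun i => dotp (a i) z ^ 2) - nrm z ^ 2 • (1 : Matrix (Fin N) (Fin N) ℝ) -
      (2 : ℝ) • outer z) ≤ ε * nrm z ^ 2 := by
  refine opN_le_of_quadratic ?_ (by positivity) fun u => ?_
  · refine ((empCov_isHermitian _ _).sub ?_).sub ?_
    · ext p q; simp [Matrix.one_apply, eq_comm]
    · ext p q; simp [outer, mul_comm]
  · have e : dotp u ((empCov a (fun i => dotp (a i) z ^ 2) -
        nrm z ^ 2 • (1 : Matrix (Fin N) (Fin N) ℝ) - (2 : ℝ) • outer z).mulVec u) =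
        (m : ℝ)⁻¹ * ∑ i, dotp (a i) z ^ 2 * dotp (a i) u ^ 2 - popMean z u := by
      rw [Matrix.sub_mulVec, Matrix.sub_mulVec, dotp_sub, dotp_sub, Matrix.smul_mulVec,
        Matrix.smul_mulVec, dotp_smul, dotp_smul, dotp_empCov_mulVec, dotp_outer_mulVec,
        Matrix.one_mulVec, nrm_sq, popMean]
      simp only [dotp, sq]
      ring
    rw [e, nrm_sq]
    exact (h u).trans_eq (by ring)

end PR


namespace PR

lemma popMean_smul {N : ℕ} (s t : ℝ) (z u : Fin N → ℝ) :
    popMean (s • z) (t • u) = s ^ 2 * t ^ 2 * popMean z u := by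
  have h1 : dotp (s • z) (t • u) = s * t * dotp z u := by
    simp only [dotp, Finset.mul_sum, Pi.smul_apply, smul_eq_mul]
    exact Finset.sum_congr rfl fun j _ => by ring
  simp only [popMean, h1, Pi.smul_apply, smul_eq_mul, mul_pow, ← Finset.mul_sum]
  ring

lemma sum_sq_inv_nrm_smul_le {N : ℕ} (z : Fin N → ℝ) : ∑ j, ((nrm z)⁻¹ • z) j ^ 2 ≤ 1 := by
  simp only [Pi.smul_apply, smul_eq_mul, mul_pow, ← Finset.mul_sum, ← nrm_sq, inv_pow]
  exact inv_mul_le_one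

lemma eq_zero_of_nrm_eq_zero {N : ℕ} {z : Fin N → ℝ} (hz : nrm z = 0) : z = 0 := by
  have h := nrm_sq z
  rw [hz, zero_pow two_ne_zero, eq_comm, Finset.sum_eq_zero_iff_of_nonneg
    fun _ _ => sq_nonneg _] at h
  exact funext fun j => by simpa using h j (Finset.mem_univ j)

/-- The empirical fourth-order form is uniformly within `ε` of its mean over the vectors `z` of
the unit ball with `(aᵢᵀz)² ≤ L` for all `i`. -/
def UniformlyClose {m N : ℕ} (L ε : ℝ) (a : Fin m → Fin N → ℝ) : Prop :=
  ∀ z u : Fin N → ℝ, ∑ j, z j ^ 2 ≤ 1 → ∑ j, u j ^ 2 ≤ 1 → (∀ i, dotp (a i) z ^ 2 ≤ L) →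
    |(m : ℝ)⁻¹ * ∑ i, dotp (a i) z ^ 2 * dotp (a i) u ^ 2 - popMean z u| ≤ ε

lemma UniformlyClose.abs_sub_popMean_le {m N : ℕ} {L ε : ℝ} {a : Fin m → Fin N → ℝ}
    (h : UniformlyClose L ε a) {z : Fin N → ℝ} (hz : ∀ i, dotp (a i) z ^ 2 ≤ L * nrm z ^ 2)
    (u : Fin N → ℝ) :
    |(m : ℝ)⁻¹ * ∑ i, dotp (a i) z ^ 2 * dotp (a i) u ^ 2 - popMean z u| ≤
      ε * ((∑ j, z j ^ 2) * ∑ j, u j ^ 2) := by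
  by_cases hz0 : nrm z = 0
  · simp [eq_zero_of_nrm_eq_zero hz0, dotp, popMean]
  by_cases hu0 : nrm u = 0
  · simp [eq_zero_of_nrm_eq_zero hu0, dotp, popMean]
  have h1 := h ((nrm z)⁻¹ • z) ((nrm u)⁻¹ • u) (sum_sq_inv_nrm_smul_le z)
    (sum_sq_inv_nrm_smul_le u) fun i => by
      rw [dotp_smul, mul_pow, inv_pow, inv_mul_le_iff₀ (by positivity), mul_comm]
      exact hz i
  have e : (m : ℝ)⁻¹ * ∑ i, dotp (a i) ((nrm z)⁻¹ • z) ^ 2 * dotp (a i) ((nrm u)⁻¹ • u) ^ 2 -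
      popMean ((nrm z)⁻¹ • z) ((nrm u)⁻¹ • u) = (nrm z ^ 2 * nrm u ^ 2)⁻¹ *
        ((m : ℝ)⁻¹ * ∑ i, dotp (a i) z ^ 2 * dotp (a i) u ^ 2 - popMean z u) := by
    rw [popMean_smul, mul_sub, Finset.mul_sum, Finset.mul_sum, Finset.mul_sum]
    congr 1
    · refine Finset.sum_congr rfl fun i _ => ?_
      rw [dotp_smul, dotp_smul, mul_inv]
      ring
    · rw [mul_inv]; ring
  have hpos : 0 < nrm z ^ 2 * nrm u ^ 2 := by positivity
  rw [e, abs_mul, abs_inv, abs_of_pos hpos, inv_mul_le_iff₀ hpos] at h1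
  rw [← nrm_sq, ← nrm_sq]
  linarith

lemma dotp_single_one {N : ℕ} (x : Fin N → ℝ) (j : Fin N) : dotp x (Pi.single j 1) = x j := by
  simp [dotp, Pi.single_apply]

lemma nrm_single_one {N : ℕ} (j : Fin N) : nrm (Pi.single j 1 : Fin N → ℝ) = 1 := by
  simp [nrm, Pi.single_apply]

lemma exp_neg_mul_log {m : ℕ} (hm : 0 < m) (k : ℕ) :
    Real.exp (-(k * Real.log m)) = ((m : ℝ) ^ k)⁻¹ := by
  rw [Real.exp_neg, Real.exp_nat_mul, Real.exp_log (by exact_mod_cast hm)]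

/-- A fixed direction is incoherent with the design with high probability. -/
lemma design_real_coherent_le {m N : ℕ} (hm : 0 < m) (v : Fin N → ℝ) :
    (design m N).real {a | ∃ i, 10 * √(Real.log m) * nrm v < |dotp (a i) v|} ≤
      2 * ((m : ℝ) ^ 24)⁻¹ := by
  have hm1 : (1 : ℝ) ≤ m := by exact_mod_cast hm
  have hlog : 0 ≤ Real.log m := Real.log_nonneg hm1
  have hset : {a : Fin m → Fin N → ℝ | ∃ i, 10 * √(Real.log m) * nrm v < |dotp (a i) v|} ⊆
      ⋃ i ∈ (Finset.univ : Finset (Fin m)),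
        {a | 10 * √(Real.log m) ≤ |dotp (a i) ((nrm v)⁻¹ • v)|} := by
    rintro a ⟨i, hi⟩
    simp only [Set.mem_iUnion, Finset.mem_univ, exists_prop, true_and]
    refine ⟨i, ?_⟩
    by_cases hv : nrm v = 0
    · simp [eq_zero_of_nrm_eq_zero hv, dotp, nrm] at hi
    · have hv' : 0 < nrm v := lt_of_le_of_ne (Real.sqrt_nonneg _) (Ne.symm hv)
      simp only [Set.mem_ofPred_eq]
      rw [dotp_smul, abs_mul, abs_inv, abs_of_pos hv', le_inv_mul_iff₀ hv', mul_comm]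
      exact hi.le
  have hi : ∀ i : Fin m, (design m N).real
      {a | 10 * √(Real.log m) ≤ |dotp (a i) ((nrm v)⁻¹ • v)|} ≤ 2 * ((m : ℝ) ^ 25)⁻¹ := by
    intro i
    refine (design_real_abs_dotp_ge_le i (sum_sq_inv_nrm_smul_le v) (by positivity)).trans_eq ?_
    rw [mul_pow, Real.sq_sqrt hlog, ← exp_neg_mul_log hm]
    congr 3
    push_cast; ring
  refine (measureReal_mono hset (measure_ne_top _ _)).trans
    ((measureReal_biUnion_finset_le _ _).trans ?_)
  refine (Finset.sum_le_card_nsmul _ _ _ fun i _ => hi i).trans_eq ?_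
  rw [Finset.card_univ, Fintype.card_fin, nsmul_eq_mul, pow_succ _ 24]
  field_simp

/-- All coordinates of the design are at most `m` in absolute value with high probability. -/
lemma design_real_exists_coord_gt_le {m N : ℕ} (hm : 100 ≤ m) (hN : N ≤ m) :
    (design m N).real {a | ∃ i j, (m : ℝ) < |a i j|} ≤ 2 * ((m : ℝ) ^ 10)⁻¹ := by
  have hmR : (100 : ℝ) ≤ m := by exact_mod_cast hm
  have hlog : 0 ≤ Real.log m := Real.log_nonneg (by linarith)
  have hsqrt : 10 * √(Real.log m) ≤ m := by
    have h1 : Real.log m ≤ m := Real.log_le_self (by linarith)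
    nlinarith [Real.sq_sqrt hlog, Real.sqrt_nonneg (Real.log m)]
  have hset : {a : Fin m → Fin N → ℝ | ∃ i j, (m : ℝ) < |a i j|} ⊆
      ⋃ j ∈ (Finset.univ : Finset (Fin N)),
        {a | ∃ i, 10 * √(Real.log m) * nrm (Pi.single j 1 : Fin N → ℝ) <
          |dotp (a i) (Pi.single j 1)|} := by
    rintro a ⟨i, j, hij⟩
    simp only [Set.mem_iUnion, Finset.mem_univ, exists_prop, true_and]
    refine ⟨j, i, ?_⟩
    rw [nrm_single_one, dotp_single_one, mul_one]
    exact hsqrt.trans_lt hij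
  refine (measureReal_mono hset (measure_ne_top _ _)).trans
    ((measureReal_biUnion_finset_le _ _).trans ?_)
  refine (Finset.sum_le_card_nsmul _ _ _ fun j _ =>
    design_real_coherent_le (by omega) (Pi.single j 1)).trans ?_
  rw [Finset.card_univ, Fintype.card_fin, nsmul_eq_mul]
  calc (N : ℝ) * (2 * ((m : ℝ) ^ 24)⁻¹) ≤ m * (2 * ((m : ℝ) ^ 24)⁻¹) := by gcongr
    _ = 2 * ((m : ℝ) ^ 23)⁻¹ := by rw [pow_succ _ 23]; field_simp
    _ ≤ 2 * ((m : ℝ) ^ 10)⁻¹ := by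
        gcongr
        · linarith
        · norm_num

lemma abs_empirical_sub_le_of_net {m N : ℕ} {a : Fin m → Fin N → ℝ} (hm : 0 < m) (hN : N ≤ m)
    {L : ℝ} (hL : 0 ≤ L) (ha : ∀ i j, |a i j| ≤ m) {z z' u u' : Fin N → ℝ}
    (hz : ∑ j, z j ^ 2 ≤ 1) (hz' : ∑ j, z' j ^ 2 ≤ 1)
    (hu : ∑ j, u j ^ 2 ≤ 1) (hu' : ∑ j, u' j ^ 2 ≤ 1)
    (hzz : ∀ j, |z j - z' j| ≤ 1 / (m ^ 9 : ℕ)) (huu : ∀ j, |u j - u' j| ≤ 1 / (m ^ 9 : ℕ)) :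
    |(m : ℝ)⁻¹ * ∑ i, truncProd L z u (a i) - popMean z u| ≤
      |(m : ℝ)⁻¹ * ∑ i, truncProd L z' u' (a i) - popMean z' u'| + 16 * (m : ℝ)⁻¹ := by
  have hm1 : (1 : ℝ) ≤ m := by exact_mod_cast hm
  have hN' : (N : ℝ) ≤ m := by exact_mod_cast hN
  have hp := abs_popMean_sub_le hz hz' hu hu' hzz huu
  have ht := fun i => abs_truncProd_sub_le hL (by positivity) (ha i) hz hz' hu hu' hzz huu
  have hs : |(m : ℝ)⁻¹ * ∑ i, truncProd L z u (a i) - (m : ℝ)⁻¹ * ∑ i, truncProd L z' u' (a i)| ≤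
      4 * (N * m) ^ 4 * (1 / (m ^ 9 : ℕ)) := by
    rw [← mul_sub, ← Finset.sum_sub_distrib, abs_mul, abs_inv, Nat.abs_cast,
      inv_mul_le_iff₀ (by positivity)]
    refine (Finset.abs_sum_le_sum_abs _ _).trans ?_
    refine (Finset.sum_le_card_nsmul _ _ _ fun i _ => ht i).trans_eq ?_
    rw [Finset.card_univ, Fintype.card_fin, nsmul_eq_mul]
  have b1 : 4 * (N * m : ℝ) ^ 4 * (1 / (m ^ 9 : ℕ)) ≤ 4 * (m : ℝ)⁻¹ := by
    calc 4 * (N * m : ℝ) ^ 4 * (1 / (m ^ 9 : ℕ)) ≤ 4 * (m * m : ℝ) ^ 4 * (1 / (m ^ 9 : ℕ)) := by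
          gcongr
      _ = 4 * (m : ℝ)⁻¹ := by push_cast; field_simp
  have b2 : 12 * (N : ℝ) * (1 / (m ^ 9 : ℕ)) ≤ 12 * (m : ℝ)⁻¹ := by
    calc 12 * (N : ℝ) * (1 / (m ^ 9 : ℕ)) ≤ 12 * (m : ℝ) ^ 8 * (1 / (m ^ 9 : ℕ)) := by
          gcongr
          exact hN'.trans (le_self_pow₀ hm1 (by norm_num))
      _ = 12 * (m : ℝ)⁻¹ := by push_cast; field_simp
  rw [abs_le] at hp hs
  have c1 := neg_abs_le ((m : ℝ)⁻¹ * ∑ i, truncProd L z' u' (a i) - popMean z' u')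
  have c2 := le_abs_self ((m : ℝ)⁻¹ * ∑ i, truncProd L z' u' (a i) - popMean z' u')
  rw [abs_le]
  constructor <;> linarith

lemma card_net_mul_exp_le {m N c : ℕ} (hm : 3 ≤ m) (hN : 1 ≤ N)
    (hc : c ≤ (2 * m ^ 9 + 1) ^ N) :
    ((c * c : ℕ) : ℝ) * (2 * Real.exp (-(40 * (N * Real.log m)))) ≤ 2 * ((m : ℝ) ^ 10)⁻¹ := by
  have hm0 : 0 < m := by omega
  have h1 : 2 * m ^ 9 + 1 ≤ m ^ 10 := by
    have : 1 ≤ m ^ 9 := Nat.one_le_pow _ _ hm0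
    rw [pow_succ]; nlinarith
  have h2 : c * c ≤ m ^ (20 * N) := by
    have : c ≤ (m ^ 10) ^ N := hc.trans (Nat.pow_le_pow_left h1 N)
    calc c * c ≤ (m ^ 10) ^ N * (m ^ 10) ^ N := Nat.mul_le_mul this this
      _ = m ^ (20 * N) := by ring
  have h3 : ((c * c : ℕ) : ℝ) ≤ (m : ℝ) ^ (20 * N) := by exact_mod_cast h2
  have h4 : Real.exp (-(40 * (N * Real.log m))) = ((m : ℝ) ^ (40 * N))⁻¹ := by
    rw [← exp_neg_mul_log hm0]; congr 2; push_cast; ring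
  have hmR : (1 : ℝ) ≤ m := by exact_mod_cast hm0
  rw [h4]
  calc ((c * c : ℕ) : ℝ) * (2 * ((m : ℝ) ^ (40 * N))⁻¹)
      ≤ (m : ℝ) ^ (20 * N) * (2 * ((m : ℝ) ^ (40 * N))⁻¹) := by gcongr
    _ = 2 * ((m : ℝ) ^ (20 * N))⁻¹ := by
        rw [show 40 * N = 20 * N + 20 * N by ring, pow_add]; field_simp
    _ ≤ 2 * ((m : ℝ) ^ 10)⁻¹ := by gcongr; omega

/-- Uniform concentration of the empirical fourth-order form over incoherent vectors. -/
lemma design_real_not_uniformlyClose_le {m N : ℕ} {t L : ℝ} (hm : 100 ≤ m) (hN1 : 1 ≤ N)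
    (hN : N ≤ m) (ht : m * t ^ 2 = N * Real.log m) (htm : (m : ℝ)⁻¹ ≤ t) (hL : 1 ≤ L)
    (htL : t * L ≤ 1 / 16) (hexp : Real.exp (-(L / 16)) ≤ t) :
    (design m N).real {a | ¬ UniformlyClose L (1600060 * t) a} ≤ 4 * ((m : ℝ) ^ 10)⁻¹ := by
  have hm0 : 0 < m := by omega
  have hmR : (0 : ℝ) < m := by exact_mod_cast hm0
  have ht0 : 0 < t := (inv_pos.mpr hmR).trans_le htm
  obtain ⟨S, hcard, hball, hnet⟩ := exists_net N (K := m ^ 9) (by positivity)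
  set r : ℝ := 1600040 * (m * t ^ 2) with hr
  set E : ℝ → (Fin N → ℝ) × (Fin N → ℝ) → Set (Fin m → Fin N → ℝ) := fun θ p =>
    {a | r ≤ θ * ∑ i, (truncProd L p.1 p.2 (a i) - popMean p.1 p.2)} with hE
  have hEle : ∀ p ∈ S ×ˢ S, (design m N).real (E t p ∪ E (-t) p) ≤
      2 * Real.exp (-(40 * (N * Real.log m))) := by
    intro p hp
    obtain ⟨h1, h2⟩ := Finset.mem_product.mp hp
    have b : ∀ θ : ℝ, |θ| = t → (design m N).real (E θ p) ≤
        Real.exp (-(40 * (N * Real.log m))) := fun θ hθ => by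
      refine (design_real_chernoff (hball _ h1) (hball _ h2) hθ hL htL hexp r).trans_eq ?_
      rw [hr, ht]; congr 1; ring
    refine (measureReal_union_le _ _).trans ?_
    linarith [b t (abs_of_pos ht0), b (-t) (by rw [abs_neg, abs_of_pos ht0])]
  have hsub : {a : Fin m → Fin N → ℝ | ¬ UniformlyClose L (1600060 * t) a} ⊆
      (⋃ p ∈ S ×ˢ S, (E t p ∪ E (-t) p)) ∪ {a | ∃ i j, (m : ℝ) < |a i j|} := by
    intro a ha
    by_contra hcon
    rw [Set.mem_union, not_or] at hcon
    obtain ⟨h1, h2⟩ := hcon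
    simp only [Set.mem_ofPred_eq, not_exists, not_lt] at h2
    refine ha fun z u hz hu hzL => ?_
    obtain ⟨z', hz'S, hzz⟩ := hnet z hz
    obtain ⟨u', hu'S, huu⟩ := hnet u hu
    have h3 : ∀ i, dotp (a i) z ^ 2 * dotp (a i) u ^ 2 = truncProd L z u (a i) := fun i => by
      rw [truncProd, min_eq_left (hzL i)]
    simp_rw [h3]
    refine (abs_empirical_sub_le_of_net hm0 hN (by linarith) h2 hz (hball _ hz'S) hu
      (hball _ hu'S) hzz huu).trans ?_
    have h4 : a ∉ E t (z', u') ∪ E (-t) (z', u') := fun hmem => h1 <| by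
      simp only [Set.mem_iUnion]
      exact ⟨(z', u'), Finset.mem_product.mpr ⟨hz'S, hu'S⟩, hmem⟩
    simp only [hE, Set.mem_union, Set.mem_ofPred_eq, not_or, not_le] at h4
    obtain ⟨h5, h6⟩ := h4
    have e : (m : ℝ)⁻¹ * ∑ i, truncProd L z' u' (a i) - popMean z' u' =
        (m : ℝ)⁻¹ * ∑ i, (truncProd L z' u' (a i) - popMean z' u') := by
      rw [Finset.sum_sub_distrib, mul_sub]
      simp [hmR.ne']
    have h7 : |∑ i, (truncProd L z' u' (a i) - popMean z' u')| ≤ m * (1600040 * t) := by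
      rw [abs_le]
      constructor <;> refine le_of_mul_le_mul_left ?_ ht0 <;> linarith
    have h8 : |(m : ℝ)⁻¹ * ∑ i, truncProd L z' u' (a i) - popMean z' u'| ≤ 1600040 * t := by
      rw [e, abs_mul, abs_inv, Nat.abs_cast, inv_mul_le_iff₀ hmR]
      exact h7
    linarith
  refine (measureReal_mono hsub).trans ((measureReal_union_le _ _).trans ?_)
  have hA : (design m N).real (⋃ p ∈ S ×ˢ S, (E t p ∪ E (-t) p)) ≤ 2 * ((m : ℝ) ^ 10)⁻¹ := by
    refine (measureReal_biUnion_finset_le _ _).trans ?_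
    refine (Finset.sum_le_card_nsmul _ _ _ hEle).trans ?_
    rw [Finset.card_product, nsmul_eq_mul]
    exact card_net_mul_exp_le (by omega) hN1 hcard
  linarith [design_real_exists_coord_gt_le (N := N) hm hN]

end PR


namespace PR

lemma popMean_single_le {N : ℕ} (j : Fin N) (u : Fin N → ℝ) :
    popMean (Pi.single j 1) u ≤ 3 * ∑ j, u j ^ 2 := by
  have h := dotp_sq_le (Pi.single j 1 : Fin N → ℝ) u
  have h1 : ∑ i, (Pi.single j 1 : Fin N → ℝ) i ^ 2 = 1 := by
    rw [← nrm_sq, nrm_single_one, one_pow]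
  rw [h1] at h
  rw [popMean, h1]
  linarith

/-- With overwhelming probability the design is uniformly concentrated over incoherent vectors,
and a fixed direction is incoherent. -/
lemma design_real_not_uniformlyClose_or_coherent_le {m N : ℕ} {c : ℝ} (hc : 10 ≤ c) (hm : 2 ≤ m)
    (hN : 1 ≤ N) (h : ((16 * c ^ 2) ^ 2 + 1600060 ^ 2) * N * Real.log m ^ 3 < m)
    (v : Fin N → ℝ) :
    1600060 * √(N * Real.log m ^ 3 / m) ≤ 1 ∧
    (design m N).real
      {a | UniformlyClose (c ^ 2 * Real.log m) (1600060 * √(N * Real.log m ^ 3 / m)) a ∧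
        ∀ i, |dotp (a i) v| ≤ 10 * √(Real.log m) * nrm v}ᶜ ≤ 6 * ((m : ℝ) ^ 10)⁻¹ := by
  have hm2 : (2 : ℝ) ≤ m := by exact_mod_cast hm
  have hm0 : (0 : ℝ) < m := by linarith
  have hN1 : (1 : ℝ) ≤ N := by exact_mod_cast hN
  set l := Real.log m with hl
  have hl2 : 0.69 < l := by
    have := Real.log_le_log (by norm_num) hm2
    linarith [Real.log_two_gt_d9]
  have hl3 : 0.32 ≤ l ^ 3 := by
    calc (0.32 : ℝ) ≤ 0.69 ^ 3 := by norm_num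
      _ ≤ l ^ 3 := by gcongr
  have hc2 : 100 ≤ c ^ 2 := by nlinarith
  have hc4 : 0 ≤ (16 * c ^ 2) ^ 2 := by positivity
  have hNl : 0.32 * N ≤ N * l ^ 3 := by nlinarith
  have hNl0 : 0 ≤ N * l ^ 3 := by positivity
  have h1 : (16 * c ^ 2) ^ 2 * (N * l ^ 3) ≤ m := by nlinarith
  have h2 : 1600060 ^ 2 * (N * l ^ 3) ≤ m := by nlinarith
  have hNm : (N : ℝ) * 100 ≤ m := by nlinarith
  have hm100 : 100 ≤ m := by
    have : (100 : ℝ) ≤ m := by linarith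
    exact_mod_cast this
  have hNm' : N ≤ m := by
    have : (N : ℝ) ≤ m := by linarith
    exact_mod_cast this
  have hl1 : 1 ≤ l := by
    rw [hl, Real.le_log_iff_exp_le hm0]
    linarith [Real.exp_one_lt_d9]
  have hs : 1600060 * √(N * l ^ 3 / m) ≤ 1 := by
    rw [← le_div_iff₀' (by norm_num)]
    refine Real.sqrt_le_iff.mpr ⟨by norm_num, ?_⟩
    rw [div_le_iff₀ hm0]
    linarith
  refine ⟨hs, ?_⟩
  set t := √(N * l / m) with ht
  have ht2 : t ^ 2 = N * l / m := Real.sq_sqrt (by positivity)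
  have hmt : (m : ℝ)⁻¹ ≤ t := by
    refine Real.le_sqrt_of_sq_le ?_
    rw [inv_pow, inv_eq_one_div, div_le_div_iff₀ (by positivity) hm0]
    nlinarith [mul_le_mul hN1 hl1 zero_le_one (by positivity)]
  have hts : t ≤ √(N * l ^ 3 / m) := by
    refine Real.sqrt_le_sqrt ?_
    gcongr
    exact le_self_pow₀ hl1 (by norm_num)
  have htL : t * (c ^ 2 * l) ≤ 1 / 16 := by
    refine abs_le_of_sq_le_sq' ?_ (by norm_num) |>.2
    rw [mul_pow, ht2, div_mul_eq_mul_div, div_le_iff₀ hm0]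
    linarith
  have hexp : Real.exp (-(c ^ 2 * l / 16)) ≤ t := by
    refine le_trans ?_ hmt
    rw [← Real.exp_log hm0, ← Real.exp_neg]
    refine Real.exp_le_exp.mpr (neg_le_neg ?_)
    change l ≤ _
    nlinarith
  have hA := design_real_not_uniformlyClose_le (L := c ^ 2 * l) hm100 hN hNm'
    (by rw [ht2]; field_simp; rfl) hmt (by nlinarith) htL hexp
  have hB := design_real_coherent_le (by omega : 0 < m) v
  have hB' : 2 * ((m : ℝ) ^ 24)⁻¹ ≤ 2 * ((m : ℝ) ^ 10)⁻¹ := by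
    gcongr
    · linarith
    · norm_num
  refine (measureReal_mono ?_ (measure_ne_top _ _)).trans ((measureReal_union_le
    {a | ¬ UniformlyClose (c ^ 2 * l) (1600060 * t) a}
    {a | ∃ i, 10 * √l * nrm v < |dotp (a i) v|}).trans ?_)
  · intro a ha
    by_contra hcon
    simp only [Set.mem_union, Set.mem_ofPred_eq, not_or, not_not, not_exists, not_lt] at hcon
    refine ha ⟨fun z u hz hu hzL => (hcon.1 z u hz hu hzL).trans ?_, hcon.2⟩
    gcongr
  · linarith

lemma ofReal_one_sub_le_of_subset {Ω : Type*} [MeasurableSpace Ω] {μ : Measure Ω}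
    [IsProbabilityMeasure μ] {s t : Set Ω} {p : ℝ} (hst : s ⊆ t) (hs : μ.real sᶜ ≤ p) :
    ENNReal.ofReal (1 - p) ≤ μ t := by
  have h := measureReal_union_le (μ := μ) s sᶜ
  rw [Set.union_compl_self, probReal_univ] at h
  refine le_trans ?_ (measure_mono hst)
  rw [ENNReal.ofReal_le_iff_le_toReal (measure_ne_top _ _)]
  change _ ≤ μ.real s
  linarith

lemma ofReal_one_sub_le_design {m N : ℕ} {c : ℝ} (hc : 10 ≤ c) (hN : 1 ≤ N)
    (h : ((16 * c ^ 2) ^ 2 + 1600060 ^ 2) * N * Real.log m ^ 3 < m) (v : Fin N → ℝ)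
    {s : Set (Fin m → Fin N → ℝ)}
    (hs : ∀ a, 1600060 * √(N * Real.log m ^ 3 / m) ≤ 1 →
      UniformlyClose (c ^ 2 * Real.log m) (1600060 * √(N * Real.log m ^ 3 / m)) a →
      (∀ i, |dotp (a i) v| ≤ 10 * √(Real.log m) * nrm v) → a ∈ s) :
    ENNReal.ofReal (1 - 6 * (m : ℝ) ^ (-10 : ℤ)) ≤ design m N s := by
  obtain hm | hm := Nat.lt_or_ge m 2
  · interval_cases m
    · simp at h
    · rw [ENNReal.ofReal_of_nonpos (by norm_num)]
      exact zero_le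
  obtain ⟨h1, h2⟩ := design_real_not_uniformlyClose_or_coherent_le hc hm hN h v
  refine ofReal_one_sub_le_of_subset (fun a ha => hs a h1 ha.1 ha.2) (h2.trans_eq ?_)
  rw [zpow_neg]
  norm_cast

lemma UniformlyClose.opN_empCov_sub_le {m N : ℕ} {b c l ε : ℝ} {a : Fin m → Fin N → ℝ}
    (h : UniformlyClose (c ^ 2 * l) ε a) (hε : 0 ≤ ε) (hl : 0 ≤ l) (hb : 0 ≤ b) (hbc : b ≤ c)
    {z : Fin N → ℝ} (hz : ∀ i, |dotp (a i) z| ≤ b * √l * nrm z) :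
    opN (empCov a (fun i => dotp (a i) z ^ 2) - nrm z ^ 2 • (1 : Matrix (Fin N) (Fin N) ℝ) -
      (2 : ℝ) • outer z) ≤ ε * nrm z ^ 2 := by
  refine PR.opN_empCov_sub_le hε (h.abs_sub_popMean_le fun i => ?_)
  calc dotp (a i) z ^ 2 = |dotp (a i) z| ^ 2 := (sq_abs _).symm
    _ ≤ (b * √l * nrm z) ^ 2 := by gcongr; exact hz i
    _ = b ^ 2 * l * nrm z ^ 2 := by rw [mul_pow, mul_pow, Real.sq_sqrt hl]
    _ ≤ c ^ 2 * l * nrm z ^ 2 := by gcongr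

lemma UniformlyClose.opN_empCov_coord_le {m N : ℕ} {L ε : ℝ} {a : Fin m → Fin N → ℝ}
    (h : UniformlyClose L ε a) (hε : ε ≤ 1) (j : Fin N) (hj : ∀ i, a i j ^ 2 ≤ L) :
    opN (empCov a fun i => a i j ^ 2) ≤ 4 := by
  refine opN_le_of_quadratic (empCov_isHermitian _ _) (by norm_num) fun u => ?_
  have h1 := h.abs_sub_popMean_le (z := Pi.single j 1)
    (fun i => by simpa [dotp_single_one, nrm_single_one] using hj i) u
  have hu : 0 ≤ ∑ j, u j ^ 2 := Finset.sum_nonneg fun _ _ => sq_nonneg _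
  rw [← nrm_sq, nrm_single_one, one_pow, one_mul] at h1
  simp only [dotp_single_one] at h1
  rw [dotp_empCov_mulVec, abs_of_nonneg
    (mul_nonneg (by positivity) (Finset.sum_nonneg fun _ _ => by positivity))]
  have h2 := popMean_single_le j u
  have h3 := (le_abs_self _).trans h1
  nlinarith

end PR

/-- **Hessian-type matrix concentration.** (1) `(1/m) ∑ᵢ (aᵢᵀx♮)² aᵢaᵢᵀ` concentrates around
`‖x♮‖² Iₙ + 2x♮x♮ᵀ` in spectral norm; (2) uniformly over all `z` incoherent with the design,
`(1/m) ∑ᵢ (aᵢᵀz)² aᵢaᵢᵀ` concentrates around `‖z‖² Iₙ + 2zzᵀ`; (3) on this event,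
`‖(1/m) ∑ᵢ a_{i,1}² a_{i,⊥}a_{i,⊥}ᵀ‖ ≤ ‖(1/m) ∑ᵢ a_{i,1}² aᵢaᵢᵀ‖ ≤ 4`. -/
theorem hessian_concentration :
    ∃ c₀ > (0 : ℝ), ∃ Cp > (0 : ℝ),
      (∃ c₁ > (0 : ℝ), ∀ (n m : ℕ) (xs : Fin n → ℝ),
        (m : ℝ) > c₁ * n * Real.log m ^ 3 →
        PR.design m n
          {a : Fin m → Fin n → ℝ |
            PR.opN (PR.empCov a (fun i => PR.dotp (a i) xs ^ 2) -
                PR.nrm xs ^ 2 • (1 : Matrix (Fin n) (Fin n) ℝ) - (2 : ℝ) • PR.outer xs) ≤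
              c₀ * Real.sqrt (n * Real.log m ^ 3 / m) * PR.nrm xs ^ 2} ≥
        ENNReal.ofReal (1 - Cp * (m : ℝ) ^ (-10 : ℤ))) ∧
      (∀ c₂ : ℝ, 1 < c₂ → ∃ c₁ > (0 : ℝ), ∀ (k m : ℕ),
        (m : ℝ) > c₁ * ((k : ℝ) + 1) * Real.log m ^ 3 →
        PR.design m (k + 1)
          {a : Fin m → Fin (k + 1) → ℝ |
            (∀ z : Fin (k + 1) → ℝ,
              (∀ i, |PR.dotp (a i) z| ≤ c₂ * Real.sqrt (Real.log m) * PR.nrm z) →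
              PR.opN (PR.empCov a (fun i => PR.dotp (a i) z ^ 2) -
                  PR.nrm z ^ 2 • (1 : Matrix (Fin (k + 1)) (Fin (k + 1)) ℝ) -
                  (2 : ℝ) • PR.outer z) ≤
                c₀ * Real.sqrt (((k : ℝ) + 1) * Real.log m ^ 3 / m) * PR.nrm z ^ 2) ∧
            PR.opN (PR.empCov (fun i => PR.tl (a i)) (fun i => a i 0 ^ 2)) ≤
              PR.opN (PR.empCov a (fun i => a i 0 ^ 2)) ∧
            PR.opN (PR.empCov a (fun i => a i 0 ^ 2)) ≤ 4} ≥
        ENNReal.ofReal (1 - Cp * (m : ℝ) ^ (-10 : ℤ))) := by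
  refine ⟨1600060, by norm_num, 6, by norm_num,
    ⟨(16 * 10 ^ 2) ^ 2 + 1600060 ^ 2, by norm_num, fun n m xs h => ?_⟩, fun c₂ hc₂ =>
    ⟨(16 * max c₂ 10 ^ 2) ^ 2 + 1600060 ^ 2, by positivity, fun k m h => ?_⟩⟩
  · have hlog : 0 ≤ Real.log m := Real.log_natCast_nonneg m
    obtain rfl | hn := Nat.eq_zero_or_pos n
    · refine PR.ofReal_one_sub_le_of_subset (s := Set.univ) (fun a _ => ?_) ?_
      · have h0 : ∀ M : Matrix (Fin 0) (Fin 0) ℝ, PR.opN M = 0 := fun M => by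
          rw [PR.opN, Subsingleton.elim M 0]; simp
        rw [Set.mem_ofPred_eq, h0]
        positivity
      · rw [Set.compl_univ, measureReal_empty]; positivity
    · exact PR.ofReal_one_sub_le_design le_rfl hn h xs fun a _ hclose hxs =>
        hclose.opN_empCov_sub_le (by positivity) hlog (by norm_num) le_rfl hxs
  · have hlog : 0 ≤ Real.log m := Real.log_natCast_nonneg m
    have hk : ((k : ℝ) + 1) = ((k + 1 : ℕ) : ℝ) := by push_cast; rfl
    rw [hk] at h ⊢
    refine PR.ofReal_one_sub_le_design (le_max_right c₂ 10) (by omega) h (Pi.single 0 1)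
      fun a hε hclose hcoord => ⟨fun z hz => ?_, ?_, ?_⟩
    · exact hclose.opN_empCov_sub_le (by positivity) hlog (by linarith) (le_max_left _ _) hz
    · exact PR.opN_submatrix_succ_le (PR.empCov a fun i => a i 0 ^ 2)
    · refine hclose.opN_empCov_coord_le hε 0 fun i => ?_
      have hi := hcoord i
      rw [PR.dotp_single_one, PR.nrm_single_one, mul_one] at hi
      calc a i 0 ^ 2 = |a i 0| ^ 2 := (sq_abs _).symm
        _ ≤ (10 * √(Real.log m)) ^ 2 := by gcongr
        _ = 10 ^ 2 * Real.log m := by rw [mul_pow, Real.sq_sqrt hlog]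
        _ ≤ max c₂ 10 ^ 2 * Real.log m := by gcongr; exact le_max_right _ _
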